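/- arXiv:2401.06368 — 2 statements merged into one kernel-verified Lean document; each statement's English description precedes it below -/
import Mathlib

section
/- Let L be a nondegenerate integral quadratic ℤ_p-lattice of rank n and M an integral quadratic ℤ_p-lattice of rank m. Then there exists a natural number m₀ such that for every a ∈ ℤ_p with v_p(a) ≥ m₀ the following holds: for every real number D, the sequence d ↦ #Rep_{M,L}(ℤ/p^d)/p^{d(mn − n(n+1)/2)} converges to D if and only if the sequence d ↦ #Rep_{⟨a⟩⊥M,L}(ℤ/p^d)/p^{d((m+1)n − n(n+1)/2)} converges to D; in particular, whenever the local densities exist, Den(⟨a⟩⊥M, L) = Den(M, L). -/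
open Filter Topology

namespace PaperStmt

/-- Reduction mod `p^d` of a quadratic form on `ℤ_p^n` (induced form on `(ℤ/p^d)^n`). -/
noncomputable def qRed (p : ℕ) [Fact p.Prime] (d : ℕ) {n : ℕ}
    (Q : QuadraticForm ℤ_[p] (Fin n → ℤ_[p])) (x : Fin n → ZMod (p ^ d)) : ZMod (p ^ d) :=
  PadicInt.toZModPow d (Q fun i => ((x i).val : ℤ_[p]))

/-- `Rep_{M,L}(ℤ/p^d)`: module homomorphisms (encoded as matrices) preserving the induced
quadratic forms. -/
noncomputable def RepSet (p : ℕ) [Fact p.Prime] {m n : ℕ}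
    (QM : QuadraticForm ℤ_[p] (Fin m → ℤ_[p])) (QL : QuadraticForm ℤ_[p] (Fin n → ℤ_[p]))
    (d : ℕ) : Set (Matrix (Fin m) (Fin n) (ZMod (p ^ d))) :=
  {T | ∀ x : Fin n → ZMod (p ^ d), qRed p d QM (T.mulVec x) = qRed p d QL x}

/-- `PRep_{M,L}(ℤ/p^d)`: those elements of `Rep` that are isomorphisms onto a direct summand
(equivalently, split injections, i.e. left invertible). -/
noncomputable def PRepSet (p : ℕ) [Fact p.Prime] {m n : ℕ}
    (QM : QuadraticForm ℤ_[p] (Fin m → ℤ_[p])) (QL : QuadraticForm ℤ_[p] (Fin n → ℤ_[p]))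
    (d : ℕ) : Set (Matrix (Fin m) (Fin n) (ZMod (p ^ d))) :=
  {T | T ∈ RepSet p QM QL d ∧ ∃ S : Matrix (Fin n) (Fin m) (ZMod (p ^ d)), S * T = 1}

/-- The local density `Den(M,L)` exists and equals `D`. -/
noncomputable def HasDen (p : ℕ) [Fact p.Prime] {m n : ℕ}
    (QM : QuadraticForm ℤ_[p] (Fin m → ℤ_[p])) (QL : QuadraticForm ℤ_[p] (Fin n → ℤ_[p]))
    (D : ℝ) : Prop :=
  Tendsto (fun d : ℕ =>
      ((RepSet p QM QL d).ncard : ℝ) / (p : ℝ) ^ ((d : ℤ) * ((m : ℤ) * n - n * (n + 1) / 2)))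
    atTop (𝓝 D)

/-- The primitive local density `Pden(M,L)` exists and equals `D`. -/
noncomputable def HasPden (p : ℕ) [Fact p.Prime] {m n : ℕ}
    (QM : QuadraticForm ℤ_[p] (Fin m → ℤ_[p])) (QL : QuadraticForm ℤ_[p] (Fin n → ℤ_[p]))
    (D : ℝ) : Prop :=
  Tendsto (fun d : ℕ =>
      ((PRepSet p QM QL d).ncard : ℝ) / (p : ℝ) ^ ((d : ℤ) * ((m : ℤ) * n - n * (n + 1) / 2)))
    atTop (𝓝 D)

/-- The rank one quadratic lattice `⟨a⟩`, i.e. `ℤ_p` with the form `x ↦ a·x²`. -/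
noncomputable def diagLat (p : ℕ) [Fact p.Prime] (a : ℤ_[p]) :
    QuadraticForm ℤ_[p] (Fin 1 → ℤ_[p]) :=
  LinearMap.BilinMap.toQuadraticMap
    ((LinearMap.mul ℤ_[p] ℤ_[p]).compl₁₂ (a • LinearMap.proj 0) (LinearMap.proj 0))

/-- Orthogonal direct sum of quadratic lattices. -/
noncomputable def orthSum (p : ℕ) [Fact p.Prime] {m₁ m₂ : ℕ}
    (Q₁ : QuadraticForm ℤ_[p] (Fin m₁ → ℤ_[p])) (Q₂ : QuadraticForm ℤ_[p] (Fin m₂ → ℤ_[p])) :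
    QuadraticForm ℤ_[p] (Fin (m₁ + m₂) → ℤ_[p]) :=
  (QuadraticMap.prod Q₁ Q₂).comp
    ((LinearEquiv.funCongrLeft ℤ_[p] ℤ_[p] finSumFinEquiv).trans
      (LinearEquiv.sumArrowLequivProdArrow (Fin m₁) (Fin m₂) ℤ_[p] ℤ_[p])).toLinearMap

/-- The self-dual lattice `H_{2K}^+ = (H_2^+)^{⊥ K}`, with form `x ↦ Σ_i x_{2i}·x_{2i+1}`. -/
noncomputable def Hplus (p : ℕ) [Fact p.Prime] (K : ℕ) :
    QuadraticForm ℤ_[p] (Fin (2 * K) → ℤ_[p]) :=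
  LinearMap.BilinMap.toQuadraticMap
    (∑ i : Fin K, (LinearMap.mul ℤ_[p] ℤ_[p]).compl₁₂
      (LinearMap.proj ⟨2 * i.1, by have := i.2; omega⟩)
      (LinearMap.proj ⟨2 * i.1 + 1, by have := i.2; omega⟩))

/-- Nondegeneracy of a quadratic lattice (the Gram matrix of the polar form has nonzero
determinant, equivalently the form is nondegenerate over `ℚ_p`). -/
def NondegQF (p : ℕ) [Fact p.Prime] {n : ℕ}
    (Q : QuadraticForm ℤ_[p] (Fin n → ℤ_[p])) : Prop :=
  (Matrix.of fun i j : Fin n =>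
    QuadraticMap.polar (⇑Q) (Pi.single i 1) (Pi.single j 1)).det ≠ 0

theorem dvd_sub_of_toZModPow_eq (p : ℕ) [Fact p.Prime] {d : ℕ} {x y : ℤ_[p]}
    (h : PadicInt.toZModPow d x = PadicInt.toZModPow d y) : (p : ℤ_[p]) ^ d ∣ x - y := by
  rw [← Ideal.mem_span_singleton, ← PadicInt.ker_toZModPow, RingHom.mem_ker, map_sub, h, sub_self]

theorem toZModPow_val (p : ℕ) [Fact p.Prime] (d : ℕ) (x : ZMod (p ^ d)) :
    PadicInt.toZModPow d ((x.val : ℕ) : ℤ_[p]) = x := by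
  have : NeZero (p ^ d) := ⟨pow_ne_zero _ (Fact.out : p.Prime).ne_zero⟩
  rw [map_natCast, ZMod.natCast_zmod_val]

/-- The reduced form may be computed on any lift of the argument. -/
theorem qRed_toZModPow (p : ℕ) [Fact p.Prime] (d : ℕ) {n : ℕ}
    (Q : QuadraticForm ℤ_[p] (Fin n → ℤ_[p])) (x : Fin n → ℤ_[p]) :
    qRed p d Q (fun i => PadicInt.toZModPow d (x i)) = PadicInt.toZModPow d (Q x) := by
  unfold qRed
  set x' : Fin n → ℤ_[p] := fun i => (((PadicInt.toZModPow d (x i)).val : ℕ) : ℤ_[p])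
  have h : ∀ i, ∃ z, x i - x' i = (p : ℤ_[p]) ^ d * z := fun i =>
    dvd_sub_of_toZModPow_eq p (toZModPow_val p d _).symm
  choose z hz using h
  have hx : x = x' + (p : ℤ_[p]) ^ d • z := by
    ext1 i
    simp [← hz i]
  have hp : PadicInt.toZModPow d ((p : ℤ_[p]) ^ d) = 0 := by
    rw [← RingHom.mem_ker, PadicInt.ker_toZModPow]
    exact Ideal.mem_span_singleton_self _
  rw [hx, QuadraticMap.map_add Q, QuadraticMap.map_smul, QuadraticMap.polar_smul_right]
  simp [hp]

theorem qRed_orthSum_diagLat (p : ℕ) [Fact p.Prime] (d : ℕ) {m : ℕ} (a : ℤ_[p])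
    (Q : QuadraticForm ℤ_[p] (Fin m → ℤ_[p])) (z : Fin (1 + m) → ZMod (p ^ d)) :
    qRed p d (orthSum p (diagLat p a) Q) z =
      PadicInt.toZModPow d a * z (Fin.castAdd m (0 : Fin 1)) ^ 2 +
        qRed p d Q (fun j => z (Fin.natAdd 1 j)) := by
  have h : orthSum p (diagLat p a) Q (fun i => (((z i).val : ℕ) : ℤ_[p])) =
      a * (((z (Fin.castAdd m (0 : Fin 1))).val : ℕ) : ℤ_[p]) ^ 2 +
        Q (fun j => (((z (Fin.natAdd 1 j)).val : ℕ) : ℤ_[p])) := by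
    simp only [orthSum, diagLat, QuadraticMap.comp_apply, QuadraticMap.prod_apply]
    congr 1
    simp [LinearMap.funLeft]
    ring
  unfold qRed
  rw [h, map_add, map_mul, map_pow, toZModPow_val]

theorem polar_eq_dotProduct {R : Type*} [CommRing R] {n : ℕ}
    (Q : QuadraticForm R (Fin n → R)) (x v : Fin n → R) :
    QuadraticMap.polar Q x v =
      x ⬝ᵥ (Matrix.of fun i j : Fin n =>
        QuadraticMap.polar Q (Pi.single i 1) (Pi.single j 1)).mulVec v := by
  have h : (Matrix.of fun i j : Fin n =>
      QuadraticMap.polar Q (Pi.single i 1) (Pi.single j 1)) =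
        LinearMap.toMatrix₂' R Q.polarBilin := by
    ext i j
    simp [LinearMap.toMatrix₂'_apply]
  rw [h, ← Matrix.toLinearMap₂'_apply', Matrix.toLinearMap₂'_toMatrix']
  rfl

theorem exists_root_quadratic (p : ℕ) [Fact p.Prime] (q b : ℤ_[p]) :
    ∃ c : ℤ_[p], c ∈ nonunits ℤ_[p] ∧ c + q * c ^ 2 + p * b = 0 := by
  let F : Polynomial ℤ_[p] :=
    Polynomial.X + Polynomial.C q * Polynomial.X ^ 2 + Polynomial.C (p * b)
  obtain ⟨c, hc, hc', -⟩ := hensels_lemma (F := F) (a := (0 : ℤ_[p])) (by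
    have : ‖(p : ℤ_[p]) * b‖ < 1 := PadicInt.norm_lt_one_iff_dvd _ |>.2 (Dvd.intro _ rfl)
    simpa [F] using this)
  refine ⟨c, PadicInt.mem_nonunits.2 ?_, ?_⟩
  · simpa [F] using hc'
  · simpa [F] using hc

/-- A nondegenerate form absorbs every rank-one perturbation by a sufficiently small multiple
of the square of a linear form. -/
theorem exists_isometry_sub_sq (p : ℕ) [Fact p.Prime] {n : ℕ}
    (Q : QuadraticForm ℤ_[p] (Fin n → ℤ_[p])) (a : ℤ_[p])
    (ha : (Matrix.of fun i j : Fin n =>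
      QuadraticMap.polar Q (Pi.single i 1) (Pi.single j 1)).det ^ 2 * p ∣ a)
    (y : Fin n → ℤ_[p]) :
    ∃ G : Matrix (Fin n) (Fin n) ℤ_[p], IsUnit G ∧
      ∀ x, Q (G.mulVec x) = Q x - a * (y ⬝ᵥ x) ^ 2 := by
  set B := Matrix.of fun i j : Fin n => QuadraticMap.polar Q (Pi.single i 1) (Pi.single j 1)
    with hB
  obtain ⟨b, rfl⟩ := ha
  set v := B.adjugate.mulVec y with hv
  obtain ⟨c, hc, hroot⟩ := exists_root_quadratic p (Q v) b
  have hpol : ∀ x, QuadraticMap.polar Q x v = B.det * (y ⬝ᵥ x) := by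
    intro x
    rw [polar_eq_dotProduct, ← hB, hv, Matrix.mulVec_mulVec, Matrix.mul_adjugate,
      Matrix.smul_mulVec, Matrix.one_mulVec, dotProduct_smul, smul_eq_mul, dotProduct_comm]
  refine ⟨1 + Matrix.vecMulVec ((B.det * c) • v) y, ?_, fun x => ?_⟩
  · rw [Matrix.isUnit_iff_isUnit_det, Matrix.vecMulVec_eq Unit,
      Matrix.det_one_add_replicateCol_mul_replicateRow]
    have h : -(y ⬝ᵥ (B.det * c) • v) ∈ nonunits ℤ_[p] := by
      have : -(y ⬝ᵥ (B.det * c) • v) = (-(B.det * (y ⬝ᵥ v))) * c := by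
        rw [dotProduct_smul, smul_eq_mul]; ring
      rw [this]
      exact mul_mem_nonunits_right hc
    simpa using IsLocalRing.isUnit_one_sub_self_of_mem_nonunits _ h
  · have hx : (1 + Matrix.vecMulVec ((B.det * c) • v) y).mulVec x =
        x + (B.det * c * (y ⬝ᵥ x)) • v := by
      rw [Matrix.add_mulVec, Matrix.one_mulVec, Matrix.vecMulVec_mulVec]
      ext i
      simp
      ring
    rw [hx, QuadraticMap.map_add Q, QuadraticMap.map_smul, QuadraticMap.polar_smul_right, hpol]
    simp only [smul_eq_mul]
    linear_combination (B.det ^ 2 * (y ⬝ᵥ x) ^ 2) * hroot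

theorem exists_unit_qRed_sub_sq (p : ℕ) [Fact p.Prime] {n : ℕ} (d : ℕ)
    (Q : QuadraticForm ℤ_[p] (Fin n → ℤ_[p])) (a : ℤ_[p])
    (ha : (Matrix.of fun i j : Fin n =>
      QuadraticMap.polar Q (Pi.single i 1) (Pi.single j 1)).det ^ 2 * p ∣ a)
    (y : Fin n → ZMod (p ^ d)) :
    ∃ G : (Matrix (Fin n) (Fin n) (ZMod (p ^ d)))ˣ,
      ∀ x, qRed p d Q (G.val.mulVec x) =
        qRed p d Q x - PadicInt.toZModPow d a * (y ⬝ᵥ x) ^ 2 := by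
  obtain ⟨G, hG, hQ⟩ := exists_isometry_sub_sq p Q a ha (fun i => (((y i).val : ℕ) : ℤ_[p]))
  refine ⟨(hG.map (PadicInt.toZModPow (p := p) d).mapMatrix).unit, fun x => ?_⟩
  obtain ⟨x, rfl⟩ : ∃ x' : Fin n → ℤ_[p], x = fun i => PadicInt.toZModPow d (x' i) :=
    ⟨fun i => (((x i).val : ℕ) : ℤ_[p]), funext fun i => (toZModPow_val p d _).symm⟩
  have h1 : (G.map (PadicInt.toZModPow (p := p) d)).mulVec (fun i => PadicInt.toZModPow d (x i)) =
      fun i => PadicInt.toZModPow d (G.mulVec x i) :=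
    funext fun i => (RingHom.map_mulVec (PadicInt.toZModPow (p := p) d) G x i).symm
  have h2 : (y ⬝ᵥ fun i => PadicInt.toZModPow d (x i)) =
      PadicInt.toZModPow d ((fun i => (((y i).val : ℕ) : ℤ_[p])) ⬝ᵥ x) := by
    rw [RingHom.map_dotProduct]
    congr 1
    exact funext fun i => (toZModPow_val p d _).symm
  rw [IsUnit.unit_spec, RingHom.mapMatrix_apply, h1, h2, qRed_toZModPow, qRed_toZModPow, hQ,
    map_sub, map_mul, map_pow]

/-- A matrix with `1 + m` rows is its first row together with the matrix of the other rows. -/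
def splitFirstRow (R : Type*) (m n : ℕ) :
    Matrix (Fin (1 + m)) (Fin n) R ≃ (Fin n → R) × Matrix (Fin m) (Fin n) R where
  toFun T := (T (Fin.castAdd m (0 : Fin 1)), fun j => T (Fin.natAdd 1 j))
  invFun yT := Fin.addCases (fun _ => yT.1) yT.2
  left_inv T := by
    funext i
    refine Fin.addCases (fun j => ?_) (fun j => ?_) i
    · obtain rfl := Subsingleton.elim j 0
      exact Fin.addCases_left _
    · exact Fin.addCases_right _
  right_inv yT :=
    Prod.ext (Fin.addCases_left (motive := fun _ => Fin n → R) (left := fun _ => yT.1)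
      (right := yT.2) (0 : Fin 1)) (funext fun j =>
      Fin.addCases_right (motive := fun _ => Fin n → R) (left := fun _ => yT.1) (right := yT.2) j)

theorem mem_RepSet_orthSum_iff (p : ℕ) [Fact p.Prime] {m n : ℕ} (d : ℕ) (a : ℤ_[p])
    (QM : QuadraticForm ℤ_[p] (Fin m → ℤ_[p])) (QL : QuadraticForm ℤ_[p] (Fin n → ℤ_[p]))
    (T : Matrix (Fin (1 + m)) (Fin n) (ZMod (p ^ d)))
    (G : (Matrix (Fin n) (Fin n) (ZMod (p ^ d)))ˣ)
    (hG : ∀ x, qRed p d QL (G.val.mulVec x) =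
      qRed p d QL x - PadicInt.toZModPow d a * ((splitFirstRow _ m n T).1 ⬝ᵥ x) ^ 2) :
    T ∈ RepSet p (orthSum p (diagLat p a) QM) QL d ↔
      (splitFirstRow _ m n T).2 * G⁻¹.val ∈ RepSet p QM QL d := by
  have key : ∀ x, qRed p d (orthSum p (diagLat p a) QM) (T.mulVec x) =
      PadicInt.toZModPow d a * ((splitFirstRow _ m n T).1 ⬝ᵥ x) ^ 2 +
        qRed p d QM ((splitFirstRow _ m n T).2.mulVec x) :=
    fun x => by rw [qRed_orthSum_diagLat]; rfl
  simp only [RepSet, Set.mem_ofPred_eq]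
  constructor
  · intro h x
    have := h (G⁻¹.val.mulVec x)
    rw [key, ← eq_sub_iff_add_eq', ← hG, Matrix.mulVec_mulVec, Matrix.mulVec_mulVec,
      Units.mul_inv, Matrix.one_mulVec] at this
    exact this
  · intro h x
    have := h (G.val.mulVec x)
    rw [Matrix.mulVec_mulVec, Matrix.mul_assoc, Units.inv_mul, Matrix.mul_one, hG] at this
    rw [key, this]
    ring

theorem ncard_RepSet_orthSum (p : ℕ) [Fact p.Prime] {m n : ℕ} (d : ℕ) (a : ℤ_[p])
    (QM : QuadraticForm ℤ_[p] (Fin m → ℤ_[p])) (QL : QuadraticForm ℤ_[p] (Fin n → ℤ_[p]))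
    (ha : (Matrix.of fun i j : Fin n =>
      QuadraticMap.polar QL (Pi.single i 1) (Pi.single j 1)).det ^ 2 * p ∣ a) :
    (RepSet p (orthSum p (diagLat p a) QM) QL d).ncard =
      (p ^ d) ^ n * (RepSet p QM QL d).ncard := by
  have : NeZero (p ^ d) := ⟨pow_ne_zero _ (Fact.out : p.Prime).ne_zero⟩
  choose G hG using exists_unit_qRed_sub_sq p d QL a ha
  let e : Matrix (Fin (1 + m)) (Fin n) (ZMod (p ^ d)) ≃
      (Fin n → ZMod (p ^ d)) × Matrix (Fin m) (Fin n) (ZMod (p ^ d)) :=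
    (splitFirstRow _ m n).trans <| Equiv.prodShear (Equiv.refl _) fun y =>
      { toFun := fun T => T * (G y)⁻¹.val
        invFun := fun T => T * (G y).val
        left_inv := fun T => by simp [Matrix.mul_assoc]
        right_inv := fun T => by simp [Matrix.mul_assoc] }
  have he : RepSet p (orthSum p (diagLat p a) QM) QL d =
      e ⁻¹' (Set.univ ×ˢ RepSet p QM QL d) := by
    ext T
    rw [mem_RepSet_orthSum_iff p d a QM QL T (G (splitFirstRow _ m n T).1) (hG _)]
    simp [e]
  rw [he, ← e.image_symm_eq_preimage, Set.ncard_image_of_injective _ e.symm.injective,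
    Set.ncard_prod, Set.ncard_univ, Nat.card_eq_fintype_card, Fintype.card_fun, ZMod.card,
    Fintype.card_fin]

theorem exists_pow_dvd_of_ne_zero (p : ℕ) [Fact p.Prime] {x : ℤ_[p]} (hx : x ≠ 0) :
    ∃ k : ℕ, x ∣ (p : ℤ_[p]) ^ k := by
  refine ⟨x.valuation, ?_⟩
  conv_lhs => rw [PadicInt.unitCoeff_spec hx]
  exact (Units.mul_left_dvd).2 dvd_rfl

/-- For `L` nondegenerate of rank `n` and `M` integral of rank `m`, there is `m₀`
such that for all `a` with `v_p(a) ≥ m₀` (i.e. `p^m₀ ∣ a`) and every real `D`, the defining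
sequence of `Den(M,L)` tends to `D` iff the defining sequence of `Den(⟨a⟩⊥M, L)` tends to `D`;
in particular `Den(⟨a⟩⊥M, L) = Den(M, L)` whenever the local densities exist. -/
theorem statement1 (p : ℕ) [Fact p.Prime] (n m : ℕ)
    (QL : QuadraticForm ℤ_[p] (Fin n → ℤ_[p])) (QM : QuadraticForm ℤ_[p] (Fin m → ℤ_[p]))
    (hQL : NondegQF p QL) :
    ∃ m₀ : ℕ, ∀ a : ℤ_[p], (p : ℤ_[p]) ^ m₀ ∣ a → ∀ D : ℝ,
      HasDen p QM QL D ↔ HasDen p (orthSum p (diagLat p a) QM) QL D := by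
  obtain ⟨k, hk⟩ := exists_pow_dvd_of_ne_zero p
    (mul_ne_zero (pow_ne_zero 2 hQL) (NeZero.ne (p : ℤ_[p])))
  refine ⟨k, fun a ha D => ?_⟩
  unfold HasDen
  refine iff_of_eq (congrArg (fun f => Tendsto f atTop (𝓝 D)) (funext fun d => ?_))
  rw [ncard_RepSet_orthSum p d a QM QL (hk.trans ha)]
  have hp : (p : ℝ) ≠ 0 := Nat.cast_ne_zero.2 (Fact.out : p.Prime).ne_zero
  have hexp : (d : ℤ) * (((1 + m : ℕ) : ℤ) * n - n * (n + 1) / 2) =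
      ((d * n : ℕ) : ℤ) + (d : ℤ) * ((m : ℤ) * n - n * (n + 1) / 2) := by
    push_cast
    ring
  rw [hexp, zpow_add₀ hp, zpow_natCast, pow_mul]
  push_cast
  rw [mul_div_mul_left _ _ (pow_ne_zero _ (pow_ne_zero _ hp))]

end PaperStmt
end

section
/- For every positive integer N one has Σ_{t ∣ N} t · a_N(t) = ψ(N) · φ(N), where ψ(N) := N · Π_{p ∣ N} (1 + p^{−1}), the product running over the primes dividing N. -/
namespace PaperStmt

/-- `a_N(t) = Σ_{r ∣ t} μ(t/r)·μ(N/r)·φ(N)/φ(N/r)` (the divisions are exact when `t ∣ N`,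
resp. when `t·p ∣ N` in Statement 7). -/
def aN (N t : ℕ) : ℤ :=
  ∑ r ∈ t.divisors, ArithmeticFunction.moebius (t / r) * ArithmeticFunction.moebius (N / r) *
    ((N.totient / (N / r).totient : ℕ) : ℤ)


/-- A double sum over chains `r ∣ t ∣ n`, rearranged by the smallest term of the chain. -/
theorem sum_divisors_sum_divisors {M : Type*} [AddCommMonoid M] {n : ℕ} (hn : n ≠ 0)
    (F : ℕ → ℕ → M) :
    ∑ t ∈ n.divisors, ∑ r ∈ t.divisors, F t r =
      ∑ r ∈ n.divisors, ∑ s ∈ (n / r).divisors, F (r * s) r := by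
  rw [Finset.sum_sigma', Finset.sum_sigma']
  refine Finset.sum_bij' (fun x _ => ⟨x.2, x.1 / x.2⟩) (fun x _ => ⟨x.1 * x.2, x.1⟩) ?_ ?_ ?_ ?_ ?_
  · rintro ⟨t, r⟩ h
    simp only [Finset.mem_sigma, Nat.mem_divisors] at h ⊢
    obtain ⟨⟨htn, -⟩, hrt, -⟩ := h
    have hrn := hrt.trans htn
    exact ⟨⟨hrn, hn⟩, Nat.div_dvd_div hrt htn, (Nat.div_pos (Nat.le_of_dvd
      (Nat.pos_of_ne_zero hn) hrn) (Nat.pos_of_dvd_of_pos hrn (Nat.pos_of_ne_zero hn))).ne'⟩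
  · rintro ⟨r, s⟩ h
    simp only [Finset.mem_sigma, Nat.mem_divisors] at h ⊢
    obtain ⟨⟨hrn, -⟩, hs, -⟩ := h
    have hd : r * s ∣ n := Nat.mul_dvd_of_dvd_div hrn hs
    exact ⟨⟨hd, hn⟩, dvd_mul_right r s, ne_zero_of_dvd_ne_zero hn hd⟩
  · rintro ⟨t, r⟩ h
    simp only [Finset.mem_sigma, Nat.mem_divisors] at h
    simp [Nat.mul_div_cancel' h.2.1]
  · rintro ⟨r, s⟩ h
    simp only [Finset.mem_sigma, Nat.mem_divisors] at h
    simp [Nat.mul_div_cancel_left s (Nat.pos_of_ne_zero (ne_zero_of_dvd_ne_zero hn h.1.1))]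
  · rintro ⟨t, r⟩ h
    simp only [Finset.mem_sigma, Nat.mem_divisors] at h
    simp [Nat.mul_div_cancel' h.2.1]

theorem totient_eq_prod_primeFactors_of_squarefree {n : ℕ} (hn : Squarefree n) :
    n.totient = ∏ p ∈ n.primeFactors, (p - 1) := by
  have h := Nat.totient_mul_prod_primeFactors n
  rw [Nat.prod_primeFactors_of_squarefree hn, mul_comm] at h
  exact Nat.eq_of_mul_eq_mul_left (Nat.pos_of_ne_zero hn.ne_zero) h

theorem sum_divisors_moebius_mul_self {n : ℕ} (hn : Squarefree n) :
    ∑ d ∈ n.divisors, ArithmeticFunction.moebius d * (d : ℤ) =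
      ArithmeticFunction.moebius n * (n.totient : ℤ) := by
  have h := ArithmeticFunction.IsMultiplicative.prodPrimeFactors_one_sub_of_squarefree
    (ArithmeticFunction.id : ArithmeticFunction ℤ)
    ArithmeticFunction.isMultiplicative_id.natCast hn
  simp only [ArithmeticFunction.natCoe_apply, ArithmeticFunction.id_apply, Int.cast_id] at h
  rw [← h, totient_eq_prod_primeFactors_of_squarefree hn,
    ← ArithmeticFunction.IsMultiplicative.prod_primeFactors ArithmeticFunction.isMultiplicative_moebius hn]
  push_cast
  rw [← Finset.prod_mul_distrib]
  refine Finset.prod_congr rfl fun p hp => ?_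
  have hp := Nat.prime_of_mem_primeFactors hp
  rw [ArithmeticFunction.moebius_apply_prime hp, Nat.cast_sub hp.one_le]
  push_cast
  ring

theorem sum_divisors_moebius_sq_div {n : ℕ} (hn : n ≠ 0) :
    ∑ d ∈ n.divisors, (ArithmeticFunction.moebius d : ℚ) ^ 2 / d =
      ∏ p ∈ n.primeFactors, (1 + (p : ℚ)⁻¹) := by
  have h : ∑ d ∈ n.divisors, (ArithmeticFunction.moebius d : ℚ) ^ 2 / d =
      ∑ d ∈ n.divisors with Squarefree d, (d : ℚ)⁻¹ := by
    rw [Finset.sum_filter]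
    refine Finset.sum_congr rfl fun d _ => ?_
    have := ArithmeticFunction.moebius_sq (n := d)
    rw [← Int.cast_pow, this]
    split_ifs <;> simp
  rw [h, Nat.sum_divisors_filter_squarefree hn, Finset.prod_one_add, Nat.factors_eq]
  refine Finset.sum_congr rfl fun s _ => ?_
  rw [Finset.prod_val]
  simp

/-- `Σ_{t ∣ N} t·a_N(t) = ψ(N)·φ(N)` where
`ψ(N) = N·Π_{p ∣ N}(1 + p^{−1})`. -/
theorem statement9 (N : ℕ) (hN : 0 < N) :
    ∑ t ∈ N.divisors, (t : ℚ) * (aN N t : ℚ) =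
      ((N : ℚ) * ∏ p ∈ N.primeFactors, (1 + (p : ℚ)⁻¹)) * (N.totient : ℚ) := by
  have hN' := hN.ne'
  have key : ∀ d ∈ N.divisors, ∑ s ∈ d.divisors, ((N / d * s : ℕ) : ℚ) *
      ((ArithmeticFunction.moebius s * ArithmeticFunction.moebius d *
        ((N.totient / d.totient : ℕ) : ℤ) : ℤ) : ℚ) =
      N * N.totient * ((ArithmeticFunction.moebius d : ℚ) ^ 2 / d) := by
    intro d hd
    have hdN := Nat.dvd_of_mem_divisors hd
    have hd0 : d ≠ 0 := ne_zero_of_dvd_ne_zero hN' hdN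
    by_cases hsq : Squarefree d
    · have hsum : ∑ s ∈ d.divisors, (ArithmeticFunction.moebius s : ℚ) * (s : ℚ) =
          (ArithmeticFunction.moebius d : ℚ) * (d.totient : ℚ) := by
        exact_mod_cast sum_divisors_moebius_mul_self hsq
      have hφ : (d.totient : ℚ) ≠ 0 := by
        exact_mod_cast (Nat.totient_pos.2 (Nat.pos_of_ne_zero hd0)).ne'
      have hdQ : (d : ℚ) ≠ 0 := by exact_mod_cast hd0
      calc _ = (N / d : ℚ) * ArithmeticFunction.moebius d * (N.totient / d.totient) *
            ∑ s ∈ d.divisors, (ArithmeticFunction.moebius s : ℚ) * (s : ℚ) := by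
            rw [Finset.mul_sum]
            refine Finset.sum_congr rfl fun s _ => ?_
            rw [Nat.cast_mul, Int.cast_mul, Int.cast_mul, Int.cast_natCast,
              Nat.cast_div hdN hdQ, Nat.cast_div (Nat.totient_dvd_of_dvd hdN) hφ]
            ring
        _ = _ := by
            rw [hsum]
            field_simp
    · simp [ArithmeticFunction.moebius_eq_zero_of_not_squarefree hsq]
  simp only [aN, Int.cast_sum, Finset.mul_sum]
  rw [sum_divisors_sum_divisors hN', ← Nat.sum_div_divisors]
  trans ∑ d ∈ N.divisors, (N : ℚ) * N.totient * ((ArithmeticFunction.moebius d : ℚ) ^ 2 / d)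
  · refine Finset.sum_congr rfl fun d hd => ?_
    have hdN := Nat.dvd_of_mem_divisors hd
    rw [← key d hd, Nat.div_div_self hdN hN']
    refine Finset.sum_congr rfl fun s _ => ?_
    rw [Nat.mul_div_cancel_left s (Nat.div_pos (Nat.le_of_dvd hN hdN)
      (Nat.pos_of_dvd_of_pos hdN hN))]
  · rw [← Finset.mul_sum, sum_divisors_moebius_sq_div hN']
    ring

end PaperStmt
end
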